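/- Let d ≥ 1, n ≥ 1, and u ∈ ℝ^d. For (s,t) ∈ Δ₂ set t_j = j/n for j = 0,…,n, α_j(s,t) = λ([s,t] ∩ [t_{j−1}, t_j]) (λ Lebesgue measure), and σ²(s,t) = (t − s) − n ∑_{j=1}^n α_j(s,t)². Define q_{u,n}(x₁,…,x_n) = ∫_{Δ₂} p^d_{σ²(s,t)}(n ∑_{j=1}^n α_j(s,t)(x_j − x_{j−1}) − u) ds dt (with x₀ = 0). Then ∫_{(ℝ^d)^n} q_{u,n}(x₁,…,x_n) ∏_{j=1}^n p^d_{1/n}(x_j − x_{j−1}) dx₁ ⋯ dx_n = m(u,d), where m(u,d) = ∫_{Δ₂} p^d_{t−s}(u) ds dt. -/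

import Mathlib

open MeasureTheory Real

/-- The `d`-dimensional Gaussian density with variance parameter `ε`. -/
noncomputable def gaussD (d : ℕ) (ε : ℝ) (z : EuclideanSpace ℝ (Fin d)) : ℝ :=
  (2 * Real.pi * ε) ^ (-(d : ℝ) / 2) * Real.exp (-‖z‖ ^ 2 / (2 * ε))

/-- The simplex `Δ₂ = {(s,t) ∈ [0,1]² : s < t}`. -/
def Delta2 : Set (ℝ × ℝ) := {p | 0 ≤ p.1 ∧ p.1 < p.2 ∧ p.2 ≤ 1}

/-- `α_j(s,t) = λ([s,t] ∩ [t_{j-1},t_j])` where `t_j = j/n`. -/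
noncomputable def alphaJ (n : ℕ) (s t : ℝ) (j : Fin n) : ℝ :=
  (volume (Set.Icc s t ∩ Set.Icc ((j : ℝ) / n) (((j : ℝ) + 1) / n))).toReal

/-- `σ²(s,t) = (t - s) - n ∑_j α_j(s,t)²`. -/
noncomputable def sigma2 (n : ℕ) (s t : ℝ) : ℝ :=
  (t - s) - n * ∑ j : Fin n, alphaJ n s t j ^ 2

/-- The increment `x_j - x_{j-1}`, with the convention `x₀ = 0`. -/
noncomputable def padDiff {n d : ℕ} (x : Fin n → EuclideanSpace ℝ (Fin d)) (j : Fin n) :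
    EuclideanSpace ℝ (Fin d) :=
  (Fin.cons 0 x : Fin (n + 1) → EuclideanSpace ℝ (Fin d)) j.succ -
    (Fin.cons 0 x : Fin (n + 1) → EuclideanSpace ℝ (Fin d)) j.castSucc

lemma gaussD_nonneg (d : ℕ) {ε : ℝ} (hε : 0 ≤ ε) (z : EuclideanSpace ℝ (Fin d)) :
    0 ≤ gaussD d ε z := by
  unfold gaussD
  positivity

lemma gaussD_sub_comm (d : ℕ) (ε : ℝ) (z w : EuclideanSpace ℝ (Fin d)) :
    gaussD d ε (z - w) = gaussD d ε (w - z) := by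
  rw [gaussD, gaussD, norm_sub_rev]

lemma measurable_gaussD (d : ℕ) :
    Measurable fun q : ℝ × EuclideanSpace ℝ (Fin d) => gaussD d q.1 q.2 := by
  unfold gaussD
  fun_prop

lemma integral_gaussD (d : ℕ) {ε : ℝ} (hε : 0 < ε) :
    ∫ z : EuclideanSpace ℝ (Fin d), gaussD d ε z = 1 := by
  unfold gaussD
  have h := GaussianFourier.integral_rexp_neg_mul_sq_norm
    (V := EuclideanSpace ℝ (Fin d)) (b := 1 / (2 * ε)) (by positivity)
  have h2 : ∀ z : EuclideanSpace ℝ (Fin d),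
      -‖z‖ ^ 2 / (2 * ε) = -(1 / (2 * ε)) * ‖z‖ ^ 2 := fun z => by ring
  simp_rw [h2, integral_const_mul, h]
  rw [finrank_euclideanSpace_fin, show π / (1 / (2 * ε)) = 2 * π * ε by field_simp, neg_div,
    Real.rpow_neg (by positivity)]
  exact inv_mul_cancel₀ (by positivity)

/-- Completing the square in a product of two Gaussian densities. -/
lemma gaussD_mul_gaussD (d : ℕ) {a ε : ℝ} (ha : 0 < a) (hε : 0 < ε) (c : ℝ)
    (u y : EuclideanSpace ℝ (Fin d)) :
    gaussD d a (c • y - u) * gaussD d ε y =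
      gaussD d (a + ε * c ^ 2) u *
        gaussD d (a * ε / (a + ε * c ^ 2)) (y - (ε * c / (a + ε * c ^ 2)) • u) := by
  have hA : 0 < a + ε * c ^ 2 := by positivity
  unfold gaussD
  rw [mul_mul_mul_comm, mul_mul_mul_comm ((2 * π * (a + ε * c ^ 2)) ^ (-(d : ℝ) / 2)),
    ← Real.mul_rpow (by positivity) (by positivity),
    ← Real.mul_rpow (by positivity) (by positivity), ← Real.exp_add, ← Real.exp_add]
  congr 2
  · field_simp
  · rw [norm_sub_sq_real, norm_sub_sq_real, norm_smul, norm_smul, inner_smul_left,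
      inner_smul_right, mul_pow, mul_pow, Real.norm_eq_abs, Real.norm_eq_abs, sq_abs, sq_abs]
    simp only [conj_trivial]
    field_simp
    ring

lemma lintegral_gaussD_mul_gaussD (d : ℕ) {a ε : ℝ} (ha : 0 < a) (hε : 0 < ε) (c : ℝ)
    (u : EuclideanSpace ℝ (Fin d)) :
    ∫⁻ y : EuclideanSpace ℝ (Fin d), ENNReal.ofReal (gaussD d a (c • y - u) * gaussD d ε y) =
      ENNReal.ofReal (gaussD d (a + ε * c ^ 2) u) := by
  have hA : 0 < a + ε * c ^ 2 := by positivity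
  have hB : 0 < a * ε / (a + ε * c ^ 2) := by positivity
  have hint : Integrable fun z : EuclideanSpace ℝ (Fin d) =>
      gaussD d (a * ε / (a + ε * c ^ 2)) z :=
    .of_integral_ne_zero (by rw [integral_gaussD d hB]; exact one_ne_zero)
  simp_rw [gaussD_mul_gaussD d ha hε]
  rw [← ofReal_integral_eq_lintegral_ofReal ((hint.comp_sub_right _).const_mul _)
      (.of_forall fun y => mul_nonneg (gaussD_nonneg d hA.le _) (gaussD_nonneg d hB.le _)),
    integral_const_mul, integral_sub_right_eq_self (fun y => gaussD d (a * ε / (a + ε * c ^ 2)) y),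
    integral_gaussD d hB, mul_one]

lemma lintegral_fin_cons {E : Type*} [MeasureSpace E] [SigmaFinite (volume : Measure E)] {k : ℕ}
    {F : (Fin (k + 1) → E) → ENNReal} (hF : Measurable F) :
    ∫⁻ x, F x = ∫⁻ z : E, ∫⁻ w : Fin k → E, F (Fin.cons z w : Fin (k + 1) → E) := by
  have hmp := (volume_preserving_piFinSuccAbove (fun _ : Fin (k + 1) => E) 0).symm
  rw [← hmp.lintegral_comp hF, Measure.volume_eq_prod]
  refine (lintegral_prod _ (hF.comp hmp.measurable).aemeasurable).trans ?_
  refine lintegral_congr fun z => lintegral_congr fun w => congrArg F ?_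
  exact Fin.insertNth_zero' z w

/-- Iterated convolution of a Gaussian density with the transition densities of a Gaussian walk
started at `x₀`. -/
lemma lintegral_gaussD_walk (d : ℕ) {a ε : ℝ} (ha : 0 < a) (hε : 0 < ε) :
    ∀ (k : ℕ) (c : Fin k → ℝ) (x₀ u : EuclideanSpace ℝ (Fin d)),
    ∫⁻ x : Fin k → EuclideanSpace ℝ (Fin d),
        ENNReal.ofReal (gaussD d a (∑ j, c j •
            ((Fin.cons x₀ x : Fin (k + 1) → EuclideanSpace ℝ (Fin d)) j.succ -
              (Fin.cons x₀ x : Fin (k + 1) → EuclideanSpace ℝ (Fin d)) j.castSucc) - u) *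
          ∏ j : Fin k, gaussD d ε
            ((Fin.cons x₀ x : Fin (k + 1) → EuclideanSpace ℝ (Fin d)) j.succ -
              (Fin.cons x₀ x : Fin (k + 1) → EuclideanSpace ℝ (Fin d)) j.castSucc)) =
      ENNReal.ofReal (gaussD d (a + ε * ∑ j, c j ^ 2) u) := by
  intro k
  induction k with
  | zero =>
    intro c x₀ u
    rw [Measure.volume_pi_eq_dirac]
    simp [gaussD]
  | succ k ih =>
    intro c x₀ u
    have hS : 0 < a + ε * ∑ j : Fin k, c j.succ ^ 2 := by positivity
    have hg := measurable_gaussD d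
    have hcons : Measurable fun x : Fin (k + 1) → EuclideanSpace ℝ (Fin d) =>
        (Fin.cons x₀ x : Fin (k + 2) → EuclideanSpace ℝ (Fin d)) :=
      measurable_pi_iff.2 (Fin.cases (by simp) (fun i => by simpa using measurable_pi_apply i))
    have hdiff : ∀ j : Fin (k + 1), Measurable fun x : Fin (k + 1) → EuclideanSpace ℝ (Fin d) =>
        (Fin.cons x₀ x : Fin (k + 2) → EuclideanSpace ℝ (Fin d)) j.succ -
          (Fin.cons x₀ x : Fin (k + 2) → EuclideanSpace ℝ (Fin d)) j.castSucc := fun j =>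
      ((measurable_pi_apply j.succ).comp hcons).sub ((measurable_pi_apply j.castSucc).comp hcons)
    have hmeas : Measurable fun x : Fin (k + 1) → EuclideanSpace ℝ (Fin d) =>
        ENNReal.ofReal (gaussD d a (∑ j, c j •
            ((Fin.cons x₀ x : Fin (k + 2) → EuclideanSpace ℝ (Fin d)) j.succ -
              (Fin.cons x₀ x : Fin (k + 2) → EuclideanSpace ℝ (Fin d)) j.castSucc) - u) *
          ∏ j : Fin (k + 1), gaussD d ε
            ((Fin.cons x₀ x : Fin (k + 2) → EuclideanSpace ℝ (Fin d)) j.succ -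
              (Fin.cons x₀ x : Fin (k + 2) → EuclideanSpace ℝ (Fin d)) j.castSucc)) := by
      refine (Measurable.mul ?_ ?_).ennreal_ofReal
      · exact hg.comp (measurable_const.prodMk
          ((Finset.measurable_sum _ fun j _ => (hdiff j).const_smul (c j)).sub_const u))
      · exact Finset.measurable_prod _ fun j _ => hg.comp (measurable_const.prodMk (hdiff j))
    have hinner : ∀ z : EuclideanSpace ℝ (Fin d),
        ∫⁻ w : Fin k → EuclideanSpace ℝ (Fin d),
          ENNReal.ofReal (gaussD d a (∑ j, c j •
            ((Fin.cons x₀ (Fin.cons z w : Fin (k + 1) → EuclideanSpace ℝ (Fin d)) :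
                Fin (k + 2) → EuclideanSpace ℝ (Fin d)) j.succ -
              (Fin.cons x₀ (Fin.cons z w : Fin (k + 1) → EuclideanSpace ℝ (Fin d)) :
                Fin (k + 2) → EuclideanSpace ℝ (Fin d)) j.castSucc) - u) *
          ∏ j : Fin (k + 1), gaussD d ε
            ((Fin.cons x₀ (Fin.cons z w : Fin (k + 1) → EuclideanSpace ℝ (Fin d)) :
                Fin (k + 2) → EuclideanSpace ℝ (Fin d)) j.succ -
              (Fin.cons x₀ (Fin.cons z w : Fin (k + 1) → EuclideanSpace ℝ (Fin d)) :
                Fin (k + 2) → EuclideanSpace ℝ (Fin d)) j.castSucc)) =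
        ENNReal.ofReal (gaussD d (a + ε * ∑ j : Fin k, c j.succ ^ 2) (c 0 • (z - x₀) - u) *
          gaussD d ε (z - x₀)) := by
      intro z
      rw [ENNReal.ofReal_mul (gaussD_nonneg d hS.le _), gaussD_sub_comm,
        ← ih (fun j => c j.succ) z, ← lintegral_mul_const' _ _ ENNReal.ofReal_ne_top]
      refine lintegral_congr fun w => ?_
      rw [← ENNReal.ofReal_mul (mul_nonneg (gaussD_nonneg d ha.le _)
        (Finset.prod_nonneg fun j _ => gaussD_nonneg d hε.le _))]
      congr 1
      rw [Fin.sum_univ_succ, Fin.prod_univ_succ]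
      simp only [Fin.cons_succ, Fin.castSucc_zero, Fin.cons_zero, Fin.castSucc_succ]
      rw [show ∀ p q r : EuclideanSpace ℝ (Fin d), q - (r - p) = p + q - r from
        fun p q r => by abel]
      ring
    rw [lintegral_fin_cons hmeas, lintegral_congr hinner,
      lintegral_sub_right_eq_self (fun z => ENNReal.ofReal
        (gaussD d (a + ε * ∑ j : Fin k, c j.succ ^ 2) (c 0 • z - u) * gaussD d ε z)) x₀,
      lintegral_gaussD_mul_gaussD d hS hε, Fin.sum_univ_succ]
    congr 2
    ring

lemma alphaJ_eq (n : ℕ) (s t : ℝ) (j : Fin n) :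
    alphaJ n s t j = max (min t (((j : ℝ) + 1) / n) - max s ((j : ℝ) / n)) 0 := by
  rw [alphaJ, Set.Icc_inter_Icc, Real.volume_Icc, ENNReal.toReal_ofReal']

lemma alphaJ_nonneg (n : ℕ) (s t : ℝ) (j : Fin n) : 0 ≤ alphaJ n s t j :=
  ENNReal.toReal_nonneg

lemma measurable_alphaJ (n : ℕ) (j : Fin n) :
    Measurable fun p : ℝ × ℝ => alphaJ n p.1 p.2 j := by
  simp_rw [alphaJ_eq]
  fun_prop

lemma measurable_sigma2 (n : ℕ) : Measurable fun p : ℝ × ℝ => sigma2 n p.1 p.2 := by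
  have := measurable_alphaJ n
  unfold sigma2
  fun_prop

lemma natCast_mul_alphaJ_le_one {n : ℕ} (hn : 1 ≤ n) (s t : ℝ) (j : Fin n) :
    n * alphaJ n s t j ≤ 1 := by
  have hn' : (0 : ℝ) < n := by exact_mod_cast hn
  have h : alphaJ n s t j ≤ 1 / n := by
    rw [alphaJ_eq]
    refine max_le ?_ (by positivity)
    have h1 := min_le_right t (((j : ℝ) + 1) / n)
    have h2 := le_max_right s ((j : ℝ) / n)
    have h3 : ((j : ℝ) + 1) / n = (j : ℝ) / n + 1 / n := add_div _ _ _
    linarith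
  rw [le_div_iff₀ hn'] at h
  linarith

lemma sum_alphaJ {n : ℕ} (hn : 1 ≤ n) {s t : ℝ} (hs : 0 ≤ s) (hst : s ≤ t) (ht : t ≤ 1) :
    ∑ j : Fin n, alphaJ n s t j = t - s := by
  have hn' : (0 : ℝ) < n := by exact_mod_cast hn
  have key : ∀ j : Fin n, alphaJ n s t j =
      max s (min t (((j : ℕ) + 1 : ℕ) / (n : ℝ))) - max s (min t ((j : ℕ) / (n : ℝ))) := by
    intro j
    have hab : (j : ℝ) / n ≤ ((j : ℝ) + 1) / n := by gcongr; linarith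
    rw [alphaJ_eq]
    push_cast
    grind
  simp_rw [key]
  rw [Fin.sum_univ_eq_sum_range
    (fun j : ℕ => max s (min t ((j + 1 : ℕ) / (n : ℝ))) - max s (min t ((j : ℕ) / (n : ℝ)))) n,
    Finset.sum_range_sub (fun j : ℕ => max s (min t ((j : ℕ) / (n : ℝ)))), div_self hn'.ne']
  simp [ht, hst, hs, hs.trans hst]

lemma sigma2_eq_sum {n : ℕ} (hn : 1 ≤ n) {s t : ℝ} (hs : 0 ≤ s) (hst : s ≤ t) (ht : t ≤ 1) :
    sigma2 n s t = ∑ j : Fin n, alphaJ n s t j * (1 - n * alphaJ n s t j) := by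
  rw [sigma2, ← sum_alphaJ hn hs hst ht, Finset.mul_sum, ← Finset.sum_sub_distrib]
  exact Finset.sum_congr rfl fun j _ => by ring

/-- The conditional variance is positive unless `s` is a grid point. -/
lemma sigma2_pos {n : ℕ} (hn : 1 ≤ n) {s t : ℝ} (hs : 0 ≤ s) (hst : s < t) (ht : t ≤ 1)
    (hgrid : ∀ k : ℕ, s ≠ k / n) : 0 < sigma2 n s t := by
  have hn' : (0 : ℝ) < n := by exact_mod_cast hn
  have hsn : 0 ≤ s * n := by positivity
  have hfloor : ⌊s * n⌋₊ < n := by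
    rw [Nat.floor_lt hsn]
    nlinarith
  have h1 : ((⌊s * n⌋₊ : ℕ) : ℝ) / n < s := by
    refine lt_of_le_of_ne ?_ (hgrid _).symm
    rw [div_le_iff₀ hn']
    exact Nat.floor_le hsn
  have h2 : s < (((⌊s * n⌋₊ : ℕ) : ℝ) + 1) / n := by
    rw [lt_div_iff₀ hn']
    exact Nat.lt_floor_add_one _
  rw [sigma2_eq_sum hn hs hst.le ht]
  refine Finset.sum_pos' (fun j _ => mul_nonneg (alphaJ_nonneg n s t j)
    (sub_nonneg.2 (natCast_mul_alphaJ_le_one hn s t j)))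
    ⟨⟨⌊s * n⌋₊, hfloor⟩, Finset.mem_univ _, ?_⟩
  have hα : alphaJ n s t ⟨⌊s * n⌋₊, hfloor⟩ =
      min t ((((⌊s * n⌋₊ : ℕ) : ℝ) + 1) / n) - s := by
    rw [alphaJ_eq, max_eq_left h1.le, max_eq_left (sub_nonneg.2 (le_min hst.le h2.le))]
  have h3 : min t ((((⌊s * n⌋₊ : ℕ) : ℝ) + 1) / n) - s < 1 / n := by
    have := min_le_right t ((((⌊s * n⌋₊ : ℕ) : ℝ) + 1) / n)
    have h4 : (((⌊s * n⌋₊ : ℕ) : ℝ) + 1) / n = ((⌊s * n⌋₊ : ℕ) : ℝ) / n + 1 / n := add_div _ _ _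
    linarith
  rw [hα]
  refine mul_pos (sub_pos.2 (lt_min hst h2)) (sub_pos.2 ?_)
  rw [lt_div_iff₀ hn'] at h3
  linarith

lemma measurableSet_Delta2 : MeasurableSet Delta2 := by
  have h1 : MeasurableSet {p : ℝ × ℝ | 0 ≤ p.1} := measurableSet_le measurable_const measurable_fst
  have h2 : MeasurableSet {p : ℝ × ℝ | p.1 < p.2} := measurableSet_lt measurable_fst measurable_snd
  have h3 : MeasurableSet {p : ℝ × ℝ | p.2 ≤ 1} := measurableSet_le measurable_snd measurable_const
  exact h1.inter (h2.inter h3)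

lemma ae_sigma2_pos {n : ℕ} (hn : 1 ≤ n) :
    ∀ᵐ p ∂volume.restrict Delta2, 0 < sigma2 n p.1 p.2 := by
  have hc : (Set.range fun k : ℕ => (k : ℝ) / n).Countable := Set.countable_range _
  have h1 : ∀ᵐ s : ℝ, s ∉ Set.range fun k : ℕ => (k : ℝ) / n := hc.ae_notMem _
  have h2 : ∀ᵐ p : ℝ × ℝ, p.1 ∉ Set.range fun k : ℕ => (k : ℝ) / n :=
    Measure.quasiMeasurePreserving_fst.ae h1
  rw [ae_restrict_iff' measurableSet_Delta2]
  filter_upwards [h2] with p hp hmem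
  exact sigma2_pos hn hmem.1 hmem.2.1 hmem.2.2 fun k hk => hp ⟨k, hk.symm⟩

lemma volume_Delta2_lt_top : volume Delta2 < ⊤ := by
  refine lt_of_le_of_lt (measure_mono (t := Set.Icc 0 1 ×ˢ Set.Icc 0 1) ?_)
    (isCompact_Icc.prod isCompact_Icc).measure_lt_top
  rintro p ⟨h0, h1, h2⟩
  exact ⟨⟨h0, by linarith⟩, ⟨by linarith, h2⟩⟩

/-- Integrability of a function of `t - s` over a sheared rectangle. -/
lemma integrableOn_sub_iff {A B : Set ℝ} (hA : volume A ≠ ⊤) (hA0 : volume A ≠ 0) (g : ℝ → ℝ) :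
    IntegrableOn (fun p : ℝ × ℝ => g (p.2 - p.1)) {p | p.1 ∈ A ∧ p.2 - p.1 ∈ B} ↔
      IntegrableOn g B := by
  have hmp := measurePreserving_prod_add (volume : Measure ℝ) (volume : Measure ℝ)
  have hemb : MeasurableEmbedding fun z : ℝ × ℝ => (z.1, z.1 + z.2) :=
    (MeasurableEquiv.shearAddRight ℝ).measurableEmbedding
  rw [← Measure.volume_eq_prod] at hmp
  rw [← hmp.integrableOn_comp_preimage hemb]
  have hpre : (fun z : ℝ × ℝ => (z.1, z.1 + z.2)) ⁻¹' {p | p.1 ∈ A ∧ p.2 - p.1 ∈ B} =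
      A ×ˢ B := by
    ext z
    simp
  have : IsFiniteMeasure (volume.restrict A) := ⟨by simpa using hA.lt_top⟩
  rw [hpre, IntegrableOn, Measure.volume_eq_prod, ← Measure.prod_restrict, IntegrableOn,
    ← Integrable.comp_snd_iff (f := g) (ν := volume.restrict B) (μ := volume.restrict A)
      (by simpa using hA0)]
  simp [Function.comp_def]

lemma measurable_padDiff {n d : ℕ} (j : Fin n) :
    Measurable fun x : Fin n → EuclideanSpace ℝ (Fin d) => padDiff x j := by
  have hcons : Measurable fun x : Fin n → EuclideanSpace ℝ (Fin d) =>
      (Fin.cons 0 x : Fin (n + 1) → EuclideanSpace ℝ (Fin d)) :=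
    measurable_pi_iff.2 (Fin.cases (by simp) (fun i => by simpa using measurable_pi_apply i))
  exact ((measurable_pi_apply j.succ).comp hcons).sub
    ((measurable_pi_apply j.castSucc).comp hcons)

lemma measurable_gaussD_bridge (d n : ℕ) (u : EuclideanSpace ℝ (Fin d)) :
    Measurable fun q : (Fin n → EuclideanSpace ℝ (Fin d)) × (ℝ × ℝ) =>
      gaussD d (sigma2 n q.2.1 q.2.2)
        ((n : ℝ) • ∑ j : Fin n, alphaJ n q.2.1 q.2.2 j • padDiff q.1 j - u) := by
  refine (measurable_gaussD d).comp (((measurable_sigma2 n).comp measurable_snd).prodMk ?_)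
  refine ((Finset.measurable_sum _ fun j _ => ?_).const_smul (n : ℝ)).sub_const u
  exact ((measurable_alphaJ n j).comp measurable_snd).smul
    ((measurable_padDiff j).comp measurable_fst)

lemma lintegral_gaussD_bridge (d : ℕ) {n : ℕ} (hn : 1 ≤ n) (u : EuclideanSpace ℝ (Fin d))
    {s t : ℝ} (hσ : 0 < sigma2 n s t) :
    ∫⁻ x : Fin n → EuclideanSpace ℝ (Fin d),
        ENNReal.ofReal (gaussD d (sigma2 n s t)
            ((n : ℝ) • ∑ j : Fin n, alphaJ n s t j • padDiff x j - u) *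
          ∏ j : Fin n, gaussD d (1 / n) (padDiff x j)) =
      ENNReal.ofReal (gaussD d (t - s) u) := by
  have hn' : (0 : ℝ) < n := by exact_mod_cast hn
  have h := lintegral_gaussD_walk d hσ (one_div_pos.2 hn') n (fun j => n * alphaJ n s t j) 0 u
  have hvar : sigma2 n s t + 1 / n * ∑ j, (n * alphaJ n s t j) ^ 2 = t - s := by
    simp_rw [sigma2, mul_pow, ← Finset.mul_sum]
    field_simp
    ring
  rw [hvar] at h
  rw [← h]
  simp_rw [Finset.smul_sum, smul_smul]
  rfl

lemma integrableOn_Delta2_gaussD {d : ℕ} {u : EuclideanSpace ℝ (Fin d)} (h : d = 1 ∨ u ≠ 0) :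
    IntegrableOn (fun p : ℝ × ℝ => gaussD d (p.2 - p.1) u) Delta2 := by
  have hmeas : Measurable fun p : ℝ × ℝ => gaussD d (p.2 - p.1) u :=
    (measurable_gaussD d).comp ((measurable_snd.sub measurable_fst).prodMk measurable_const)
  rcases h with rfl | hu
  · have hg : IntegrableOn (fun r : ℝ => (2 * π) ^ (-((1 : ℕ) : ℝ) / 2) * r ^ (-(1 / 2) : ℝ))
        (Set.Ioc 0 1) :=
      (((intervalIntegral.intervalIntegrable_rpow' (by norm_num)).1).const_mul _)
    have hI := (integrableOn_sub_iff (A := Set.Icc 0 1) (by simp) (by simp) _).2 hg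
    have hsub : Delta2 ⊆ {p : ℝ × ℝ | p.1 ∈ Set.Icc (0 : ℝ) 1 ∧ p.2 - p.1 ∈ Set.Ioc (0 : ℝ) 1} :=
      fun p ⟨h0, h1, h2⟩ => ⟨⟨h0, by linarith⟩, by linarith, by linarith⟩
    refine (hI.mono_set hsub).mono' hmeas.aestronglyMeasurable ?_
    refine (ae_restrict_iff' measurableSet_Delta2).2 (.of_forall fun p ⟨h0, h1, h2⟩ => ?_)
    have hr : 0 < p.2 - p.1 := sub_pos.2 h1
    rw [Real.norm_of_nonneg (gaussD_nonneg _ hr.le _), gaussD,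
      Real.mul_rpow (by positivity) hr.le]
    rw [show -((1 : ℕ) : ℝ) / 2 = -(1 / 2) by norm_num]
    refine mul_le_of_le_one_right (by positivity) (Real.exp_le_one_iff.2 ?_)
    exact div_nonpos_of_nonpos_of_nonneg (neg_nonpos.2 (by positivity)) (by positivity)
  · have hK : 0 < ‖u‖ ^ 2 / 2 := by positivity
    have hbound : ∀ r : ℝ, 0 < r → r ≤ 1 → gaussD d r u ≤
        (2 * π) ^ (-(d : ℝ) / 2) * (d.factorial / (‖u‖ ^ 2 / 2) ^ d) := by
      intro r hr hr1
      have h1 : r ^ (-(d : ℝ) / 2) ≤ (r ^ d)⁻¹ := by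
        rw [← Real.rpow_natCast, ← Real.rpow_neg hr.le]
        refine Real.rpow_le_rpow_of_exponent_ge hr hr1 ?_
        have : (0 : ℝ) ≤ d := d.cast_nonneg
        linarith
      have h2 := Real.pow_div_factorial_le_exp (‖u‖ ^ 2 / 2 / r) (by positivity) d
      rw [gaussD, Real.mul_rpow (by positivity) hr.le, mul_assoc, neg_div (2 * r), Real.exp_neg,
        ← div_div]
      gcongr
      calc r ^ (-(d : ℝ) / 2) * (Real.exp (‖u‖ ^ 2 / 2 / r))⁻¹
          ≤ (r ^ d)⁻¹ * ((‖u‖ ^ 2 / 2 / r) ^ d / d.factorial)⁻¹ := by gcongr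
        _ = d.factorial / (‖u‖ ^ 2 / 2) ^ d := by
          rw [div_pow _ r]
          field_simp
    refine Measure.integrableOn_of_bounded volume_Delta2_lt_top.ne hmeas.aestronglyMeasurable
      (M := (2 * π) ^ (-(d : ℝ) / 2) * (d.factorial / (‖u‖ ^ 2 / 2) ^ d)) ?_
    refine (ae_restrict_iff' measurableSet_Delta2).2 (.of_forall fun p ⟨h0, h1, h2⟩ => ?_)
    have hr : 0 < p.2 - p.1 := sub_pos.2 h1
    rw [Real.norm_of_nonneg (gaussD_nonneg _ hr.le _)]
    exact hbound _ hr (by linarith)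

lemma eq_one_of_integrableOn_of_rpow_le {d : ℕ} (hd : 1 ≤ d) {δ c : ℝ} (hδ0 : 0 < δ)
    (hδ1 : δ + δ ≤ 1) (hc0 : 0 < c) {f : ℝ × ℝ → ℝ} (h : IntegrableOn f Delta2)
    (hlow : ∀ p : ℝ × ℝ, p.1 ∈ Set.Ioo 0 δ → p.2 - p.1 ∈ Set.Ioo 0 δ →
      c * (p.2 - p.1) ^ (-(d : ℝ) / 2) ≤ f p) : d = 1 := by
  let R : Set (ℝ × ℝ) := {p | p.1 ∈ Set.Ioo 0 δ ∧ p.2 - p.1 ∈ Set.Ioo 0 δ}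
  have hR : R ⊆ Delta2 := fun p ⟨⟨h0, h1⟩, h2, h3⟩ => ⟨h0.le, by linarith, by linarith⟩
  have hRm : MeasurableSet R :=
    (measurable_fst measurableSet_Ioo).inter ((measurable_snd.sub measurable_fst) measurableSet_Ioo)
  have hint : IntegrableOn (fun p : ℝ × ℝ => c * (p.2 - p.1) ^ (-(d : ℝ) / 2)) R := by
    refine (h.mono_set hR).mono' (Measurable.aestronglyMeasurable (by fun_prop)) ?_
    refine (ae_restrict_iff' hRm).2 (.of_forall fun p hp => ?_)
    have : 0 ≤ p.2 - p.1 := hp.2.1.le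
    rw [Real.norm_of_nonneg (by positivity)]
    exact hlow p hp.1 hp.2
  have hint' := (integrableOn_sub_iff (by simp) (by simpa using hδ0)
    (fun r : ℝ => c * r ^ (-(d : ℝ) / 2))).1 hint
  have hint2 : IntegrableOn (fun r : ℝ => r ^ (-(d : ℝ) / 2)) (Set.Ioo 0 δ) := by
    refine (hint'.const_mul c⁻¹).congr (.of_forall fun r => ?_)
    exact inv_mul_cancel_left₀ hc0.ne' _
  rw [intervalIntegral.integrableOn_Ioo_rpow_iff hδ0] at hint2
  have : (d : ℝ) < 2 := by linarith
  have : d < 2 := by exact_mod_cast this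
  omega

/-- For `u = 0` the integrand of the bridge average has a non-integrable singularity on the
diagonal unless the dimension is one. -/
lemma eq_one_of_integrableOn_gaussD_bridge {d n : ℕ} (hd : 1 ≤ d) (hn : 1 ≤ n)
    (x : Fin n → EuclideanSpace ℝ (Fin d))
    (h : IntegrableOn (fun p : ℝ × ℝ => gaussD d (sigma2 n p.1 p.2)
      ((n : ℝ) • ∑ j : Fin n, alphaJ n p.1 p.2 j • padDiff x j - 0)) Delta2) : d = 1 := by
  have hn' : (0 : ℝ) < n := by exact_mod_cast hn
  have hn1 : (1 : ℝ) ≤ n := by exact_mod_cast hn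
  let j₀ : Fin n := ⟨0, hn⟩
  set V : ℝ := ‖padDiff x j₀‖ ^ 2 with hV
  have hV0 : 0 ≤ V := by positivity
  set δ : ℝ := 1 / (2 * n) with hδ
  have hδ0 : 0 < δ := by positivity
  have h2δ : δ + δ = 1 / n := by rw [hδ]; field_simp; norm_num
  have hδn : n * δ = 1 / 2 := by rw [hδ]; field_simp
  have h1n : 1 / (n : ℝ) ≤ 1 := by rw [div_le_one hn']; exact hn1
  set c : ℝ := (2 * π) ^ (-(d : ℝ) / 2) * Real.exp (-(n * V)) with hc
  have hc0 : 0 < c := by positivity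
  have hlow : ∀ p : ℝ × ℝ, p.1 ∈ Set.Ioo 0 δ → p.2 - p.1 ∈ Set.Ioo 0 δ →
      c * (p.2 - p.1) ^ (-(d : ℝ) / 2) ≤ gaussD d (sigma2 n p.1 p.2)
      ((n : ℝ) • ∑ j : Fin n, alphaJ n p.1 p.2 j • padDiff x j - 0) := by
    rintro ⟨s, t⟩ ⟨h0, h1⟩ ⟨h2, h3⟩
    simp only at h0 h1 h2 h3 ⊢
    set r := t - s with hr
    have hα₀ : alphaJ n s t j₀ = r := by
      rw [alphaJ_eq]
      simp only [j₀, Nat.cast_zero, zero_div, zero_add]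
      rw [min_eq_left (by linarith), max_eq_left h0.le, max_eq_left h2.le]
    have hα : ∀ j : Fin n, j ≠ j₀ → alphaJ n s t j = 0 := by
      intro j hj
      have hj1 : (1 : ℝ) ≤ (j : ℕ) := by
        exact_mod_cast Nat.one_le_iff_ne_zero.2 fun h => hj (Fin.ext h)
      have hjn : 1 / (n : ℝ) ≤ (j : ℝ) / n := by gcongr
      rw [alphaJ_eq]
      refine max_eq_right (sub_nonpos.2 ((min_le_left _ _).trans (le_max_of_le_right ?_)))
      linarith
    have hσ : sigma2 n s t = r - n * r ^ 2 := by
      rw [sigma2, Finset.sum_eq_single j₀ (fun j _ hj => by rw [hα j hj]; ring) (by simp), hα₀]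
    have hsum : ∑ j : Fin n, alphaJ n s t j • padDiff x j = r • padDiff x j₀ := by
      rw [Finset.sum_eq_single j₀ (fun j _ hj => by rw [hα j hj, zero_smul]) (by simp), hα₀]
    have hnr : n * r ≤ 1 / 2 := by
      rw [← hδn]
      gcongr
    have hσ1 : r / 2 ≤ r - n * r ^ 2 := by nlinarith
    have hσ2 : r - n * r ^ 2 ≤ r := by nlinarith [mul_nonneg hn'.le (sq_nonneg r)]
    have hσ0 : 0 < r - n * r ^ 2 := by linarith
    rw [hsum, hσ, sub_zero, gaussD, smul_smul, norm_smul, mul_pow, ← hV, Real.norm_eq_abs, sq_abs,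
      hc, mul_right_comm, ← Real.mul_rpow (by positivity) h2.le]
    gcongr ?_ * Real.exp ?_
    · refine Real.rpow_le_rpow_of_nonpos (by positivity) (by gcongr) ?_
      exact div_nonpos_of_nonpos_of_nonneg (by simp) (by norm_num)
    · rw [neg_div]
      refine neg_le_neg ?_
      rw [div_le_iff₀ (by positivity)]
      have : (n * r) * (n * r) ≤ n * r := by
        have : 0 ≤ n * r := by positivity
        nlinarith
      have h5 : n * V * (r / 2) ≤ n * V * (r - n * r ^ 2) := by gcongr
      nlinarith [mul_le_mul_of_nonneg_right this hV0]
  exact eq_one_of_integrableOn_of_rpow_le hd hδ0 (h2δ.trans_le h1n) hc0 h hlow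

theorem stmt12 (d n : ℕ) (hd : 1 ≤ d) (hn : 1 ≤ n) (u : EuclideanSpace ℝ (Fin d)) :
    (∫ x : Fin n → EuclideanSpace ℝ (Fin d),
        (∫ p in Delta2,
            gaussD d (sigma2 n p.1 p.2)
              ((n : ℝ) • ∑ j : Fin n, alphaJ n p.1 p.2 j • padDiff x j - u)) *
          ∏ j : Fin n, gaussD d (1 / n) (padDiff x j))
      = ∫ p in Delta2, gaussD d (p.2 - p.1) u := by
  by_cases hcase : d = 1 ∨ u ≠ 0
  · have hI := integrableOn_Delta2_gaussD hcase
    have hmeas : Measurable fun q : (Fin n → EuclideanSpace ℝ (Fin d)) × (ℝ × ℝ) =>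
        gaussD d (sigma2 n q.2.1 q.2.2)
          ((n : ℝ) • ∑ j : Fin n, alphaJ n q.2.1 q.2.2 j • padDiff q.1 j - u) *
          ∏ j : Fin n, gaussD d (1 / n) (padDiff q.1 j) :=
      (measurable_gaussD_bridge d n u).mul (Finset.measurable_prod _ fun j _ =>
        (measurable_gaussD d).comp
          (measurable_const.prodMk ((measurable_padDiff j).comp measurable_fst)))
    have hpos : ∀ {s t : ℝ}, 0 < sigma2 n s t → ∀ x : Fin n → EuclideanSpace ℝ (Fin d),
        0 ≤ gaussD d (sigma2 n s t) ((n : ℝ) • ∑ j : Fin n, alphaJ n s t j • padDiff x j - u) *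
          ∏ j : Fin n, gaussD d (1 / n) (padDiff x j) := fun hσ x =>
      mul_nonneg (gaussD_nonneg d hσ.le _)
        (Finset.prod_nonneg fun j _ => gaussD_nonneg d (by positivity) _)
    have hprod : Integrable (Function.uncurry
        fun (x : Fin n → EuclideanSpace ℝ (Fin d)) (p : ℝ × ℝ) =>
          gaussD d (sigma2 n p.1 p.2)
            ((n : ℝ) • ∑ j : Fin n, alphaJ n p.1 p.2 j • padDiff x j - u) *
          ∏ j : Fin n, gaussD d (1 / n) (padDiff x j))
        (volume.prod (volume.restrict Delta2)) := by
      refine ⟨hmeas.aestronglyMeasurable, ?_⟩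
      rw [HasFiniteIntegral, lintegral_prod_symm _ (Measurable.aemeasurable (by
        exact hmeas.enorm))]
      refine lt_of_eq_of_lt (lintegral_congr_ae ?_) hI.2
      filter_upwards [ae_sigma2_pos hn, ae_restrict_mem measurableSet_Delta2] with p hσ hp
      rw [Real.enorm_of_nonneg (gaussD_nonneg d (sub_pos.2 hp.2.1).le u),
        ← lintegral_gaussD_bridge d hn u hσ]
      exact lintegral_congr fun x => Real.enorm_of_nonneg (hpos hσ x)
    simp_rw [← integral_mul_const]
    rw [integral_integral_swap hprod]
    refine integral_congr_ae ?_
    filter_upwards [ae_sigma2_pos hn, ae_restrict_mem measurableSet_Delta2] with p hσ hp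
    rw [integral_eq_lintegral_of_nonneg_ae (.of_forall (hpos hσ))
      (hmeas.comp measurable_prodMk_right).aestronglyMeasurable,
      lintegral_gaussD_bridge d hn u hσ,
      ENNReal.toReal_ofReal (gaussD_nonneg d (sub_pos.2 hp.2.1).le u)]
  · obtain ⟨hd1, rfl⟩ : d ≠ 1 ∧ u = 0 := by simpa using hcase
    rw [integral_undef (f := fun p : ℝ × ℝ => gaussD d (p.2 - p.1) 0)]
    · refine integral_eq_zero_of_ae (.of_forall fun x => ?_)
      simp only [Pi.zero_apply]
      rw [integral_undef fun h => hd1 (eq_one_of_integrableOn_gaussD_bridge hd hn x h), zero_mul]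
    · refine fun h => hd1 (eq_one_of_integrableOn_of_rpow_le hd (δ := 1 / 2)
        (c := (2 * π) ^ (-(d : ℝ) / 2)) (by norm_num) (by norm_num) (by positivity) h ?_)
      intro p _ hr
      rw [gaussD, Real.mul_rpow (by positivity) hr.1.le]
      simp
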